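/- Let f_1, …, f_k : ℕ → ℕ be functions given by polynomials with integer coefficients, and for each n let S_n ⊆ ℕ be the additive submonoid generated by f_1(n), …, f_k(n). Then there is an eventually quasi-polynomial function g : ℕ → ℤ such that for every n for which ℕ \ S_n is finite, the number of fundamental gaps of S_n (elements x ∈ ℕ with x ∉ S_n but k·x ∈ S_n for every integer k ≥ 2) equals g(n). -/

import Mathlib

/-- A function `c : ℕ → ℚ` is eventually periodic if there are `N` and `p ≥ 1`
with `c (n + p) = c n` for all `n ≥ N`. -/
def EvPeriodic (c : ℕ → ℚ) : Prop :=
  ∃ N p : ℕ, 1 ≤ p ∧ ∀ n, N ≤ n → c (n + p) = c n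

/-- A function `g : ℕ → ℤ` is eventually quasi-polynomial if
`g n = Σ_{i=0}^d c_i(n)·n^i` for eventually periodic `c_0, …, c_d : ℕ → ℚ`. -/
def IsEQP (g : ℕ → ℤ) : Prop :=
  ∃ (d : ℕ) (c : ℕ → ℕ → ℚ), (∀ i, i ≤ d → EvPeriodic (c i)) ∧
    ∀ n : ℕ, (g n : ℚ) = ∑ i ∈ Finset.range (d + 1), c i n * (n : ℚ) ^ i

/-- The additive submonoid of `ℕ` generated by `f 0 n, …, f (k-1) n`. -/
def SG (k : ℕ) (f : Fin k → ℕ → ℕ) (n : ℕ) : AddSubmonoid ℕ :=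
  AddSubmonoid.closure (Set.range fun i => f i n)

/-- The set of fundamental gaps of `SG k f n`: those `x ∉ S` with `k·x ∈ S`
for every integer `k ≥ 2`. -/
def FG (k : ℕ) (f : Fin k → ℕ → ℕ) (n : ℕ) : Set ℕ :=
  {x : ℕ | x ∉ SG k f n ∧ ∀ j : ℕ, 2 ≤ j → j * x ∈ SG k f n}

open Function

section FloorLinear

variable {ι : Type*}

/-- Integer-valued functions of integer variables built from constants and variables by addition,
multiplication by integers and floor division by positive integers. -/
inductive FloorLinear : ((ι → ℤ) → ℤ) → Prop
  | const (c : ℤ) : FloorLinear fun _ => c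
  | var (i : ι) : FloorLinear fun e => e i
  | add {s t : (ι → ℤ) → ℤ} (hs : FloorLinear s) (ht : FloorLinear t) :
      FloorLinear fun e => s e + t e
  | smul (c : ℤ) {t : (ι → ℤ) → ℤ} (ht : FloorLinear t) : FloorLinear fun e => c * t e
  | div {c : ℤ} (hc : 0 < c) {t : (ι → ℤ) → ℤ} (ht : FloorLinear t) : FloorLinear fun e => t e / c

/-- Sets of integer vectors that are Boolean combinations of sets `{e | 0 ≤ t e}` with `t` a
floor-linear function. -/
inductive FloorDefinable : Set (ι → ℤ) → Prop
  | nonneg {t : (ι → ℤ) → ℤ} (ht : FloorLinear t) : FloorDefinable {e | 0 ≤ t e}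
  | compl {A : Set (ι → ℤ)} (hA : FloorDefinable A) : FloorDefinable Aᶜ
  | inter {A B : Set (ι → ℤ)} (hA : FloorDefinable A) (hB : FloorDefinable B) :
      FloorDefinable (A ∩ B)

namespace FloorLinear

variable {s t : (ι → ℤ) → ℤ}

theorem neg (ht : FloorLinear t) : FloorLinear fun e => -t e := by
  simpa using ht.smul (-1)

theorem sub (hs : FloorLinear s) (ht : FloorLinear t) : FloorLinear fun e => s e - t e := by
  simpa [sub_eq_add_neg] using hs.add ht.neg

theorem comp_update [DecidableEq ι] (ht : FloorLinear t) (hs : FloorLinear s) (i : ι) :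
    FloorLinear fun e => t (update e i (s e)) := by
  induction ht with
  | const c => exact const c
  | var j =>
    by_cases h : j = i
    · subst h; simpa using hs
    · simpa [update_of_ne h] using var j
  | add _ _ h₁ h₂ => exact h₁.add h₂
  | smul c _ h => exact h.smul c
  | div hc _ h => exact h.div hc

/-- Along every residue class of a suitable modulus, a floor-linear function is affine in any given
variable, with a slope not depending on the other variables. -/
theorem exists_slice [DecidableEq ι] (ht : FloorLinear t) (i : ι) :
    ∃ M : ℤ, 0 < M ∧ ∀ ρ : ℤ, ∃ (a : ℤ) (t' : _),
      FloorLinear t' ∧ ∀ e x, t (update e i (M * x + ρ)) = a * x + t' e := by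
  induction ht with
  | const c => exact ⟨1, one_pos, fun ρ => ⟨0, _, const c, by simp⟩⟩
  | var j =>
    by_cases h : j = i
    · subst h; exact ⟨1, one_pos, fun ρ => ⟨1, _, const ρ, by simp⟩⟩
    · exact ⟨1, one_pos, fun ρ => ⟨0, _, var j, by simp [update_of_ne h]⟩⟩
  | add _ _ h₁ h₂ =>
    obtain ⟨M, hM, h₁⟩ := h₁
    obtain ⟨K, hK, h₂⟩ := h₂
    refine ⟨M * K, mul_pos hM hK, fun ρ => ?_⟩
    obtain ⟨a, s', hs', e₁⟩ := h₁ ρ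
    obtain ⟨b, t', ht', e₂⟩ := h₂ ρ
    refine ⟨a * K + b * M, _, hs'.add ht', fun e x => ?_⟩
    have h₁ := e₁ e (K * x)
    have h₂ := e₂ e (M * x)
    rw [show M * (K * x) + ρ = M * K * x + ρ by ring] at h₁
    rw [show K * (M * x) + ρ = M * K * x + ρ by ring] at h₂
    simp only [h₁, h₂]; ring
  | smul c _ h =>
    obtain ⟨M, hM, h⟩ := h
    refine ⟨M, hM, fun ρ => ?_⟩
    obtain ⟨a, t', ht', h⟩ := h ρ
    exact ⟨c * a, _, ht'.smul c, fun e x => by simp only [h]; ring⟩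
  | @div c hc _ _ h =>
    obtain ⟨M, hM, h⟩ := h
    refine ⟨M * c, mul_pos hM hc, fun ρ => ?_⟩
    obtain ⟨a, t', ht', h⟩ := h ρ
    refine ⟨a, _, ht'.div hc, fun e x => ?_⟩
    have h := h e (c * x)
    rw [show M * (c * x) + ρ = M * c * x + ρ by ring] at h
    simp only [h]
    rw [show a * (c * x) + t' e = t' e + c * (a * x) by ring,
      Int.add_mul_ediv_left _ _ hc.ne']
    ring

end FloorLinear

/-- The rounded-up quotient `⌈t / c⌉`. -/
theorem FloorLinear.ceilDiv {t : (ι → ℤ) → ℤ} (ht : FloorLinear t) {c : ℤ}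
    (hc : 0 < c) : FloorLinear fun e => -(-t e / c) :=
  (ht.neg.div hc).neg

theorem neg_neg_ediv_le_iff {c : ℤ} (hc : 0 < c) (t x : ℤ) : -(-t / c) ≤ x ↔ t ≤ c * x := by
  rw [neg_le, Int.le_ediv_iff_mul_le hc]
  constructor <;> intro h <;> linarith

namespace FloorDefinable

variable {A B : Set (ι → ℤ)} {s t : (ι → ℤ) → ℤ}

theorem union (hA : FloorDefinable A) (hB : FloorDefinable B) : FloorDefinable (A ∪ B) := by
  simpa [Set.compl_inter] using (hA.compl.inter hB.compl).compl

theorem le (hs : FloorLinear s) (ht : FloorLinear t) : FloorDefinable {e | s e ≤ t e} := by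
  simpa using nonneg (ht.sub hs)

theorem lt (hs : FloorLinear s) (ht : FloorLinear t) : FloorDefinable {e | s e < t e} := by
  simpa [Set.compl_def] using (le ht hs).compl

theorem eq (hs : FloorLinear s) (ht : FloorLinear t) : FloorDefinable {e | s e = t e} := by
  simpa [Set.inter_def, ← le_antisymm_iff] using (le hs ht).inter (le ht hs)

theorem empty : FloorDefinable (∅ : Set (ι → ℤ)) := by
  simpa using lt (ι := ι) (.const 0) (.const 0)

theorem biUnion {α : Type*} (l : List α) {A : α → Set (ι → ℤ)}
    (hA : ∀ a ∈ l, FloorDefinable (A a)) : FloorDefinable {e | ∃ a ∈ l, e ∈ A a} := by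
  induction l with
  | nil => simpa using empty
  | cons a l ih =>
    simpa [Set.ofPred_or] using
      (hA a (by simp)).union (ih fun b hb => hA b (List.mem_cons_of_mem _ hb))

theorem biInter {α : Type*} (l : List α) {A : α → Set (ι → ℤ)}
    (hA : ∀ a ∈ l, FloorDefinable (A a)) : FloorDefinable {e | ∀ a ∈ l, e ∈ A a} := by
  simpa [Set.compl_def] using (biUnion l (A := fun a => (A a)ᶜ) fun a ha => (hA a ha).compl).compl

theorem comp_update [DecidableEq ι] (hA : FloorDefinable A) (hs : FloorLinear s) (i : ι) :
    FloorDefinable {e | update e i (s e) ∈ A} := by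
  induction hA with
  | nonneg ht => exact nonneg (ht.comp_update hs i)
  | compl _ h => exact h.compl
  | inter _ _ h₁ h₂ => exact h₁.inter h₂

/-- Along every residue class of a suitable modulus, membership in a definable set depends on a
given variable only through its position relative to finitely many floor-linear thresholds. -/
theorem exists_thresholds [DecidableEq ι] (hA : FloorDefinable A) (i : ι) :
    ∃ M : ℤ, 0 < M ∧ ∀ ρ : ℤ, ∃ L : List ((ι → ℤ) → ℤ), (∀ s ∈ L, FloorLinear s) ∧ ∀ e x y,
      (∀ s ∈ L, s e ≤ x ↔ s e ≤ y) →
        (update e i (M * x + ρ) ∈ A ↔ update e i (M * y + ρ) ∈ A) := by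
  induction hA with
  | nonneg ht =>
    obtain ⟨M, hM, h⟩ := ht.exists_slice i
    refine ⟨M, hM, fun ρ => ?_⟩
    obtain ⟨a, t', ht', h⟩ := h ρ
    rcases lt_trichotomy a 0 with ha | rfl | ha
    · refine ⟨[fun e => t' e / (-a) + 1], by
        simpa only [List.forall_mem_singleton] using
          (ht'.div (neg_pos.2 ha)).add (.const 1),
        fun e x y hxy => ?_⟩
      have key : ∀ x, t' e / (-a) + 1 ≤ x ↔ ¬ 0 ≤ a * x + t' e := fun x => by
        rw [Int.add_one_le_iff, Int.ediv_lt_iff_lt_mul (by omega)]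
        constructor <;> intro h <;> nlinarith
      simp only [List.mem_singleton, forall_eq, key] at hxy
      simpa [h] using not_iff_not.1 hxy
    · exact ⟨[], by simp, by simp [h]⟩
    · refine ⟨[fun e => -(-(-t' e) / a)], by simpa using ht'.neg.ceilDiv ha, fun e x y hxy => ?_⟩
      simp only [List.mem_singleton, forall_eq, neg_neg_ediv_le_iff ha] at hxy
      simpa [h, neg_le_iff_add_nonneg] using hxy
  | compl _ h =>
    obtain ⟨M, hM, h⟩ := h
    refine ⟨M, hM, fun ρ => ?_⟩
    obtain ⟨L, hL, h⟩ := h ρ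
    exact ⟨L, hL, fun e x y hxy => not_congr (h e x y hxy)⟩
  | inter _ _ h₁ h₂ =>
    obtain ⟨M, hM, h₁⟩ := h₁
    obtain ⟨K, hK, h₂⟩ := h₂
    refine ⟨M * K, mul_pos hM hK, fun ρ => ?_⟩
    obtain ⟨L₁, hL₁, h₁⟩ := h₁ ρ
    obtain ⟨L₂, hL₂, h₂⟩ := h₂ ρ
    refine ⟨L₁.map (fun s e => -(-s e / K)) ++ L₂.map (fun s e => -(-s e / M)), ?_, ?_⟩
    · intro s hs
      simp only [List.mem_append, List.mem_map] at hs
      rcases hs with ⟨s, hs, rfl⟩ | ⟨s, hs, rfl⟩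
      exacts [(hL₁ s hs).ceilDiv hK, (hL₂ s hs).ceilDiv hM]
    · intro e x y hxy
      have e₁ := h₁ e (K * x) (K * y) fun s hs => by
        simpa only [neg_neg_ediv_le_iff hK] using
          hxy _ (List.mem_append_left _ (List.mem_map_of_mem hs))
      have e₂ := h₂ e (M * x) (M * y) fun s hs => by
        simpa only [neg_neg_ediv_le_iff hM] using
          hxy _ (List.mem_append_right _ (List.mem_map_of_mem hs))
      rw [← mul_assoc, ← mul_assoc] at e₁
      rw [← mul_assoc, ← mul_assoc, mul_comm K M] at e₂
      exact and_congr e₁ e₂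

/-- Quantifier elimination for a nonnegative variable. -/
theorem exists_nonneg [DecidableEq ι] (hA : FloorDefinable A) (i : ι) :
    FloorDefinable {e | ∃ x : ℤ, 0 ≤ x ∧ update e i x ∈ A} := by
  obtain ⟨M, hM, h⟩ := hA.exists_thresholds i
  choose L hL h using h
  have key : {e | ∃ x : ℤ, 0 ≤ x ∧ update e i x ∈ A} =
      {e | ∃ ρ ∈ (List.range M.toNat).map (fun r : ℕ => (r : ℤ)),
        e ∈ {e | ∃ s ∈ (fun _ => 0) :: L ρ,
          e ∈ {e | 0 ≤ s e} ∩ {e | update e i (M * s e + ρ) ∈ A}}} := by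
    ext e
    constructor
    · rintro ⟨x, hx, hxA⟩
      have hmod : 0 ≤ x % M := Int.emod_nonneg _ hM.ne'
      refine ⟨x % M, List.mem_map.2 ⟨(x % M).toNat, ?_, by simpa using hmod⟩, ?_⟩
      · have := Int.emod_lt_of_pos x hM
        simp; omega
      classical
      let T := (((fun _ => 0) :: L (x % M)).filter fun s => s e ≤ x / M).toFinset
      have hT : T.Nonempty := ⟨fun _ => 0, by simpa [T] using Int.ediv_nonneg hx hM.le⟩
      obtain ⟨s, hs, hmax⟩ := T.exists_max_image (fun s => s e) hT
      simp only [T, List.mem_toFinset, List.mem_filter, decide_eq_true_eq] at hs hmax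
      refine ⟨s, hs.1, hmax (fun _ => 0) ⟨by simp, Int.ediv_nonneg hx hM.le⟩, ?_⟩
      refine (h (x % M) e (s e) (x / M) fun u hu => ⟨fun h => h.trans hs.2, fun h =>
        hmax u ⟨List.mem_cons_of_mem _ hu, h⟩⟩).2 ?_
      rwa [Int.mul_ediv_add_emod]
    · rintro ⟨ρ, hρ, s, -, hs, hsA⟩
      obtain ⟨r, -, rfl⟩ := List.mem_map.1 hρ
      exact ⟨_, add_nonneg (mul_nonneg hM.le hs) (Int.natCast_nonneg r), hsA⟩
  rw [key]
  refine biUnion _ fun ρ _ => biUnion _ fun s hs => ?_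
  have hs' : FloorLinear s := by
    rcases List.mem_cons.1 hs with rfl | hs
    exacts [.const 0, hL ρ s hs]
  exact (nonneg hs').inter (hA.comp_update ((hs'.smul M).add (.const ρ)) i)

/-- Quantifier elimination for finitely many nonnegative variables. -/
theorem exists_nonneg_finset [DecidableEq ι] (hA : FloorDefinable A) (S : Finset ι) :
    FloorDefinable {e | ∃ v : ι → ℤ, (∀ i ∈ S, 0 ≤ v i) ∧ S.piecewise v e ∈ A} := by
  induction S using Finset.induction_on with
  | empty => simpa using hA
  | insert a S ha ih =>
    convert ih.exists_nonneg a using 1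
    ext e
    have key : ∀ (v : ι → ℤ) (x : ℤ), (insert a S).piecewise (update v a x) e =
        S.piecewise v (update e a x) := fun v x => by
      ext j
      by_cases hj : j = a
      · subst hj; simp [ha]
      · by_cases hjS : j ∈ S <;> simp [hj, hjS]
    constructor
    · rintro ⟨v, hv, hvA⟩
      refine ⟨v a, hv a (by simp), v, fun i hi => hv i (by simp [hi]), ?_⟩
      rwa [← key, update_eq_self]
    · rintro ⟨x, hx, v, hv, hvA⟩
      refine ⟨update v a x, fun i hi => ?_, by rwa [key]⟩
      by_cases hi' : i = a
      · subst hi'; simpa using hx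
      · simpa [hi'] using hv i (by simpa [hi'] using hi)

end FloorDefinable

end FloorLinear

section PiecewisePolynomial

variable {ι : Type*}

/-- Rational-valued functions of integer variables built from rational constants, floor-linear
functions and indicators `[0 ≤ t]` of floor-linear functions by addition and multiplication. -/
inductive FloorPolynomial : ((ι → ℤ) → ℚ) → Prop
  | const (q : ℚ) : FloorPolynomial fun _ => q
  | floorLinear {t : (ι → ℤ) → ℤ} (ht : FloorLinear t) : FloorPolynomial fun e => (t e : ℚ)
  | nonneg {t : (ι → ℤ) → ℤ} (ht : FloorLinear t) :
      FloorPolynomial fun e => if 0 ≤ t e then 1 else 0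
  | add {F G : (ι → ℤ) → ℚ} (hF : FloorPolynomial F) (hG : FloorPolynomial G) :
      FloorPolynomial fun e => F e + G e
  | mul {F G : (ι → ℤ) → ℚ} (hF : FloorPolynomial F) (hG : FloorPolynomial G) :
      FloorPolynomial fun e => F e * G e

/-- Functions of a vector `e` and an integer `x` that are sums of terms `c e * x ^ k` and
`c e * x ^ k * [s e ≤ x]`. -/
inductive SlicePolynomial : ((ι → ℤ) → ℤ → ℚ) → Prop
  | monomial {c : (ι → ℤ) → ℚ} (hc : FloorPolynomial c) (k : ℕ) :
      SlicePolynomial fun e x => c e * (x : ℚ) ^ k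
  | step {c : (ι → ℤ) → ℚ} (hc : FloorPolynomial c) (k : ℕ) {s : (ι → ℤ) → ℤ} (hs : FloorLinear s) :
      SlicePolynomial fun e x => c e * (x : ℚ) ^ k * if s e ≤ x then 1 else 0
  | add {G H : (ι → ℤ) → ℤ → ℚ} (hG : SlicePolynomial G) (hH : SlicePolynomial H) :
      SlicePolynomial fun e x => G e x + H e x

namespace FloorPolynomial

variable {F G : (ι → ℤ) → ℚ}

theorem congr (hF : FloorPolynomial F) (h : ∀ e, G e = F e) : FloorPolynomial G :=
  funext h ▸ hF

theorem sub (hF : FloorPolynomial F) (hG : FloorPolynomial G) :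
    FloorPolynomial fun e => F e - G e :=
  (hF.add ((const (-1)).mul hG)).congr fun e => by ring

open Classical in
theorem indicator {A : Set (ι → ℤ)} (hA : FloorDefinable A) :
    FloorPolynomial fun e => if e ∈ A then 1 else 0 := by
  induction hA with
  | nonneg ht => exact (nonneg ht).congr fun e => by simp
  | @compl A _ h =>
    exact ((const 1).sub h).congr fun e => by by_cases h : e ∈ A <;> simp [h]
  | inter _ _ h₁ h₂ => exact (h₁.mul h₂).congr fun e => by simp [← ite_and, and_comm]

theorem ite {A : Set (ι → ℤ)} (hA : FloorDefinable A) (hF : FloorPolynomial F)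
    (hG : FloorPolynomial G) [DecidablePred (· ∈ A)] :
    FloorPolynomial fun e => if e ∈ A then F e else G e :=
  (((indicator hA).mul hF).add (((const 1).sub (indicator hA)).mul hG)).congr fun e => by
    by_cases h : e ∈ A <;> simp [h]

theorem sum {α : Type*} (S : Finset α) {F : α → (ι → ℤ) → ℚ}
    (hF : ∀ a ∈ S, FloorPolynomial (F a)) : FloorPolynomial fun e => ∑ a ∈ S, F a e := by
  classical
  induction S using Finset.induction_on with
  | empty => simpa using const 0
  | insert a S ha ih =>
    exact ((hF a (by simp)).add (ih fun b hb => hF b (by simp [hb]))).congr fun e => by simp [ha]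

theorem pow (hF : FloorPolynomial F) (k : ℕ) : FloorPolynomial fun e => F e ^ k := by
  induction k with
  | zero => simpa using const 1
  | succ k ih => exact (ih.mul hF).congr fun e => pow_succ _ _

theorem polynomial_eval (P : Polynomial ℚ) (hF : FloorPolynomial F) :
    FloorPolynomial fun e => P.eval (F e) :=
  (sum (Finset.range (P.natDegree + 1)) fun i _ => (const (P.coeff i)).mul (hF.pow i)).congr
    fun e => by rw [Polynomial.eval_eq_sum_range]

end FloorPolynomial

namespace SlicePolynomial

variable {G H : (ι → ℤ) → ℤ → ℚ}

theorem congr (hG : SlicePolynomial G) (h : ∀ e x, H e x = G e x) : SlicePolynomial H :=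
  (funext fun e => funext (h e)) ▸ hG

theorem of_coeff {c : (ι → ℤ) → ℚ} (hc : FloorPolynomial c) : SlicePolynomial fun e _ => c e :=
  (monomial hc 0).congr fun e x => by simp

theorem mul (hG : SlicePolynomial G) (hH : SlicePolynomial H) :
    SlicePolynomial fun e x => G e x * H e x := by
  induction hG with
  | monomial hc k =>
    induction hH with
    | monomial hd l => exact (monomial (hc.mul hd) (k + l)).congr fun e x => by ring
    | step hd l hs => exact (step (hc.mul hd) (k + l) hs).congr fun e x => by ring
    | add _ _ h₁ h₂ => exact (h₁.add h₂).congr fun e x => by ring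
  | @step c hc k s hs =>
    induction hH with
    | monomial hd l => exact (step (hc.mul hd) (k + l) hs).congr fun e x => by ring
    | @step d hd l t ht =>
      classical
      have h₁ := (FloorPolynomial.indicator (FloorDefinable.le ht hs)).mul (hc.mul hd)
      have h₂ := (FloorPolynomial.indicator (FloorDefinable.lt hs ht)).mul (hc.mul hd)
      refine ((step h₁ (k + l) hs).add (step h₂ (k + l) ht)).congr fun e x => ?_
      simp only [Set.mem_ofPred_eq]
      rcases le_or_gt (t e) (s e) with h | h
      · by_cases h' : s e ≤ x
        · simp [h, h', h.trans h', not_lt.2 h]; ring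
        · simp [h', not_lt.2 h]
      · by_cases h' : t e ≤ x
        · simp [h, h', h.le.trans h', not_le.2 h]; ring
        · simp [h', not_le.2 h]
    | add _ _ h₁ h₂ => exact (h₁.add h₂).congr fun e x => by ring
  | add _ _ h₁ h₂ => exact (h₁.add h₂).congr fun e x => by ring

theorem comp_mul_left (hG : SlicePolynomial G) {m : ℤ} (hm : 0 < m) :
    SlicePolynomial fun e x => G e (m * x) := by
  induction hG with
  | monomial hc k =>
    exact (monomial (hc.mul (.const ((m : ℚ) ^ k))) k).congr fun e x => by push_cast; ring
  | step hc k hs =>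
    refine (step (hc.mul (.const ((m : ℚ) ^ k))) k (hs.ceilDiv hm)).congr fun e x => ?_
    simp only [neg_neg_ediv_le_iff hm]
    push_cast; ring
  | add _ _ h₁ h₂ => exact h₁.add h₂

/-- With the vector fixed, the function is eventually polynomial. -/
theorem exists_polynomial (hG : SlicePolynomial G) (e : ι → ℤ) :
    ∃ (P : Polynomial ℚ) (x₀ : ℤ), ∀ x, x₀ ≤ x → G e x = P.eval (x : ℚ) := by
  induction hG with
  | @monomial c hc k => exact ⟨.C (c e) * .X ^ k, 0, fun x _ => by simp⟩
  | @step c hc k s hs => exact ⟨.C (c e) * .X ^ k, s e, fun x hx => by simp [hx]⟩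
  | add _ _ h₁ h₂ =>
    obtain ⟨P, x₁, h₁⟩ := h₁
    obtain ⟨Q, x₂, h₂⟩ := h₂
    exact ⟨P + Q, max x₁ x₂, fun x hx => by
      simp [h₁ x (le_of_max_le_left hx), h₂ x (le_of_max_le_right hx)]⟩

end SlicePolynomial

theorem exists_polynomial_sum_range_pow (k : ℕ) :
    ∃ P : Polynomial ℚ, ∀ n : ℕ, ∑ x ∈ Finset.range n, (x : ℚ) ^ k = P.eval (n : ℚ) := by
  refine ⟨.C ((k + 1 : ℚ)⁻¹) * (Polynomial.bernoulli (k + 1) - .C (bernoulli (k + 1))), fun n => ?_⟩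
  have h := Polynomial.sum_range_pow_eq_bernoulli_sub n k
  have hk : (k + 1 : ℚ) ≠ 0 := by positivity
  simp only [Polynomial.eval_mul, Polynomial.eval_C, Polynomial.eval_sub,
    Nat.succ_eq_add_one] at h ⊢
  rw [← h]
  field_simp

/-- Summing over an initial segment of the natural numbers removes the last variable. -/
theorem SlicePolynomial.sum_range {G : (ι → ℤ) → ℤ → ℚ} (hG : SlicePolynomial G)
    {N : (ι → ℤ) → ℤ} (hN : FloorLinear N) :
    FloorPolynomial fun e => ∑ x ∈ Finset.range (N e).toNat, G e x := by
  classical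
  induction hG with
  | @monomial c hc k =>
    obtain ⟨P, hP⟩ := exists_polynomial_sum_range_pow k
    refine (FloorPolynomial.ite (.nonneg hN)
      (hc.mul (.polynomial_eval P (.floorLinear hN))) (.const 0)).congr fun e => ?_
    by_cases h : 0 ≤ N e
    · have hcast : ((N e).toNat : ℚ) = N e := by
        exact_mod_cast congrArg (Int.cast (R := ℚ)) (Int.toNat_of_nonneg h)
      simp [h, ← Finset.mul_sum, hP, hcast]
    · simp [h, Int.toNat_of_nonpos (not_le.1 h).le]
  | @step c hc k s hs =>
    obtain ⟨P, hP⟩ := exists_polynomial_sum_range_pow k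
    have hPN := FloorPolynomial.polynomial_eval P (.floorLinear hN)
    have hPs := FloorPolynomial.polynomial_eval P (.floorLinear hs)
    refine (FloorPolynomial.ite (.nonneg hN) (hc.mul
      (.ite (.le hs (.const 0)) hPN (.ite (.le hs hN) (hPN.sub hPs) (.const 0))))
      (.const 0)).congr fun e => ?_
    simp only [Set.mem_ofPred_eq]
    by_cases h : 0 ≤ N e
    · obtain ⟨n, hn⟩ := Int.eq_ofNat_of_zero_le h
      simp only [hn, Int.toNat_natCast, Int.natCast_nonneg, if_true, Int.cast_natCast, ← hP,
        mul_assoc, ← Finset.mul_sum]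
      congr 1
      split_ifs with h₁ h₂
      · exact Finset.sum_congr rfl fun x _ => by
          rw [if_pos (h₁.trans (Int.natCast_nonneg x)), mul_one]
      · obtain ⟨m, hm⟩ := Int.eq_ofNat_of_zero_le (not_le.1 h₁).le
        rw [hm] at h₂ ⊢
        have hmn : m ≤ n := by exact_mod_cast h₂
        rw [Int.cast_natCast, ← hP, ← Finset.sum_range_add_sum_Ico _ hmn,
          ← Finset.sum_range_add_sum_Ico _ hmn, add_sub_cancel_left,
          Finset.sum_eq_zero (s := Finset.range m), zero_add]
        · exact Finset.sum_congr rfl fun x hx => by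
            rw [if_pos (by exact_mod_cast (Finset.mem_Ico.1 hx).1), mul_one]
        · intro x hx
          rw [if_neg (by simpa using hx), mul_zero]
      · refine Finset.sum_eq_zero fun x hx => ?_
        have := Finset.mem_range.1 hx
        rw [if_neg (by omega), mul_zero]
    · simp [h, Int.toNat_of_nonpos (not_le.1 h).le]
  | add _ _ h₁ h₂ => exact (h₁.add h₂).congr fun e => Finset.sum_add_distrib

namespace FloorPolynomial

variable [DecidableEq ι] {F : (ι → ℤ) → ℚ}

theorem exists_slice (hF : FloorPolynomial F) (i : ι) : ∃ M : ℤ, 0 < M ∧ ∀ ρ : ℤ,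
    SlicePolynomial fun e x => F (update e i (M * x + ρ)) := by
  have common {F G : (ι → ℤ) → ℚ}
      (hF : ∃ M : ℤ, 0 < M ∧ ∀ ρ : ℤ, SlicePolynomial fun e x => F (update e i (M * x + ρ)))
      (hG : ∃ M : ℤ, 0 < M ∧ ∀ ρ : ℤ, SlicePolynomial fun e x => G (update e i (M * x + ρ))) :
      ∃ M : ℤ, 0 < M ∧ ∀ ρ : ℤ, SlicePolynomial (fun e x => F (update e i (M * x + ρ))) ∧
        SlicePolynomial fun e x => G (update e i (M * x + ρ)) := by
    obtain ⟨M, hM, hF⟩ := hF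
    obtain ⟨K, hK, hG⟩ := hG
    refine ⟨M * K, mul_pos hM hK, fun ρ => ⟨((hF ρ).comp_mul_left hK).congr fun e x => ?_,
      ((hG ρ).comp_mul_left hM).congr fun e x => ?_⟩⟩
    · rw [mul_assoc]
    · rw [mul_comm M, mul_assoc]
  induction hF with
  | const q => exact ⟨1, one_pos, fun ρ => .of_coeff (.const q)⟩
  | floorLinear ht =>
    obtain ⟨M, hM, h⟩ := ht.exists_slice i
    refine ⟨M, hM, fun ρ => ?_⟩
    obtain ⟨a, t', ht', h⟩ := h ρ
    exact ((SlicePolynomial.monomial (.const (a : ℚ)) 1).add (.of_coeff (.floorLinear ht'))).congr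
      fun e x => by simp [h]
  | nonneg ht =>
    obtain ⟨M, hM, h⟩ := ht.exists_slice i
    refine ⟨M, hM, fun ρ => ?_⟩
    obtain ⟨a, t', ht', h⟩ := h ρ
    simp only [h]
    rcases lt_trichotomy a 0 with ha | rfl | ha
    · have hs := (ht'.div (neg_pos.2 ha)).add (.const 1)
      refine ((SlicePolynomial.of_coeff (.const 1)).add (.step (.const (-1)) 0 hs)).congr
        fun e x => ?_
      have key : t' e / (-a) + 1 ≤ x ↔ ¬ 0 ≤ a * x + t' e := by
        rw [Int.add_one_le_iff, Int.ediv_lt_iff_lt_mul (by omega)]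
        constructor <;> intro h <;> nlinarith
      simp only [key]
      by_cases h : 0 ≤ a * x + t' e <;> simp [h]
    · exact (SlicePolynomial.of_coeff (.nonneg ht')).congr fun e x => by simp
    · refine (SlicePolynomial.step (.const 1) 0 (ht'.neg.ceilDiv ha)).congr fun e x => ?_
      simp only [neg_neg_ediv_le_iff ha, neg_le_iff_add_nonneg]
      simp
  | add _ _ h₁ h₂ =>
    obtain ⟨M, hM, h⟩ := common h₁ h₂
    exact ⟨M, hM, fun ρ => (h ρ).1.add (h ρ).2⟩
  | mul _ _ h₁ h₂ =>
    obtain ⟨M, hM, h⟩ := common h₁ h₂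
    exact ⟨M, hM, fun ρ => (h ρ).1.mul (h ρ).2⟩

end FloorPolynomial

/-- Splitting the sum over an initial segment into residue classes. -/
theorem sum_range_eq_sum_residues {m : ℕ} (hm : 0 < m) (n : ℕ) (φ : ℕ → ℚ) :
    ∑ x ∈ Finset.range n, φ x = ∑ r ∈ Finset.range m,
      ∑ x ∈ Finset.range (-(-((n : ℤ) - r) / m)).toNat, φ (m * x + r) := by
  have hm' : (0 : ℤ) < m := by exact_mod_cast hm
  have key : ∀ r x : ℕ, x < (-(-((n : ℤ) - r) / m)).toNat ↔ m * x + r < n := fun r x => by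
    rw [Int.lt_toNat, ← not_le, neg_neg_ediv_le_iff hm', not_le, lt_sub_iff_add_lt]
    exact_mod_cast Iff.rfl
  rw [Finset.sum_sigma']
  refine Finset.sum_bij' (fun x _ => ⟨x % m, x / m⟩) (fun p _ => m * p.2 + p.1) ?_ ?_ ?_ ?_ ?_
  · intro x hx
    simp only [Finset.mem_sigma, Finset.mem_range, key, Nat.div_add_mod]
    exact ⟨Nat.mod_lt x hm, Finset.mem_range.1 hx⟩
  · intro p hp
    simp only [Finset.mem_sigma, Finset.mem_range, key] at hp
    simpa using hp.2
  · intro x _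
    exact Nat.div_add_mod x m
  · rintro ⟨r, x⟩ hp
    simp only [Finset.mem_sigma, Finset.mem_range] at hp
    simp [Nat.mod_eq_of_lt hp.1, Nat.mul_add_div hm, Nat.div_eq_of_lt hp.1]
  · intro x _
    simp [Nat.div_add_mod]

/-- Summing a floor-polynomial function over an initial segment in one of its variables. -/
theorem FloorPolynomial.sum_range [DecidableEq ι] {F : (ι → ℤ) → ℚ} (hF : FloorPolynomial F)
    {N : (ι → ℤ) → ℤ} (hN : FloorLinear N) (i : ι) :
    FloorPolynomial fun e => ∑ x ∈ Finset.range (N e).toNat, F (update e i x) := by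
  obtain ⟨M, hM, h⟩ := hF.exists_slice i
  lift M to ℕ using hM.le
  have hM' : 0 < M := by exact_mod_cast hM
  classical
  refine (ite (.nonneg hN) (sum (Finset.range M) fun r _ =>
    (h r).sum_range ((hN.sub (.const r)).ceilDiv hM)) (const 0)).congr fun e => ?_
  by_cases h : 0 ≤ N e
  · obtain ⟨n, hn⟩ := Int.eq_ofNat_of_zero_le h
    simp only [Set.mem_ofPred_eq, hn, Int.toNat_natCast, Int.natCast_nonneg, if_true]
    rw [sum_range_eq_sum_residues hM' n fun x => F (update e i x)]
    push_cast
    rfl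
  · simp [h, Int.toNat_of_nonpos (not_le.1 h).le]

/-- A function that eventually agrees with a floor-polynomial function of one variable is
eventually quasi-polynomial. -/
theorem FloorPolynomial.isEQP [DecidableEq ι] {F : (ι → ℤ) → ℚ} (hF : FloorPolynomial F)
    (e : ι → ℤ) (i : ι) {g : ℕ → ℤ} {n₀ : ℕ}
    (hg : ∀ n : ℕ, n₀ ≤ n → (g n : ℚ) = F (update e i n)) : IsEQP g := by
  obtain ⟨M, hM, h⟩ := hF.exists_slice i
  lift M to ℕ using hM.le
  have hM' : 0 < M := by exact_mod_cast hM
  have h' := fun r : ℕ => (h r).exists_polynomial e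
  choose P x₀ hP using h'
  let Q : ℕ → Polynomial ℚ := fun r => (P r).comp (.C (M : ℚ)⁻¹ * (.X - .C (r : ℚ)))
  let N : ℕ := max n₀ (M * (∑ r ∈ Finset.range M, (x₀ r).toNat))
  have hQ : ∀ n : ℕ, N ≤ n → (g n : ℚ) = (Q (n % M)).eval (n : ℚ) := fun n hn => by
    have hmod := Nat.mod_lt n hM'
    have hx : x₀ (n % M) ≤ (n / M : ℕ) := by
      refine (Int.self_le_toNat _).trans (Int.ofNat_le.2 ?_)
      refine (Finset.single_le_sum (f := fun r => (x₀ r).toNat) (fun _ _ => Nat.zero_le _)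
        (Finset.mem_range.2 hmod)).trans ?_
      rw [Nat.le_div_iff_mul_le hM', mul_comm]
      exact (le_max_right _ _).trans hn
    have hdiv : ((M * (n / M : ℕ) + (n % M : ℕ) : ℕ) : ℚ) = n := by rw [Nat.div_add_mod]
    have hval := hP (n % M) (n / M : ℕ) hx
    rw [hg n ((le_max_left _ _).trans hn)]
    rw [show ((M : ℤ) * ((n / M : ℕ) : ℤ) + ((n % M : ℕ) : ℤ)) = n by
      exact_mod_cast Nat.div_add_mod n M] at hval
    rw [hval]
    have hM0 : (M : ℚ) ≠ 0 := by positivity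
    simp only [Q, Polynomial.eval_comp, Polynomial.eval_mul, Polynomial.eval_C,
      Polynomial.eval_sub, Polynomial.eval_X, Int.cast_natCast]
    congr 1
    rw [← hdiv]
    push_cast
    field_simp
    ring
  let d : ℕ := (Finset.range M).sup fun r => (Q r).natDegree
  refine ⟨d, fun j n => if N ≤ n then (Q (n % M)).coeff j else if j = 0 then (g n : ℚ) else 0,
    fun j _ => ⟨N, M, hM', fun n hn => ?_⟩, fun n => ?_⟩
  · simp [hn, hn.trans (Nat.le_add_right n M)]
  · by_cases hn : N ≤ n
    · simp only [hn, if_true]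
      rw [hQ n hn]
      refine Polynomial.eval_eq_sum_range' (Nat.lt_succ_of_le ?_) _
      exact Finset.le_sup (f := fun r => (Q r).natDegree) (Finset.mem_range.2 (Nat.mod_lt n hM'))
    · simp [hn]

end PiecewisePolynomial

section Digits

variable {κ : Type*}

/-- Vectors consisting of a base `n ≥ 1` (the coordinate `none`) and of base-`n` digits. -/
def digitBox (κ : Type*) : Set (Option κ → ℤ) :=
  {e | 1 ≤ e none ∧ ∀ i, 0 ≤ e (some i) ∧ e (some i) < e none}

/-- Functions `t₀ + n t₁ + n² t₂ + ⋯` of a base `n` and of base-`n` digits, with finitely many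
floor-linear coefficients `t_j` of size `O(n)`. -/
inductive DigitExpansion : ((Option κ → ℤ) → ℤ) → Prop
  | zero : DigitExpansion fun _ => 0
  | cons {t h : (Option κ → ℤ) → ℤ} (ht : FloorLinear t) (c : ℤ)
      (hc : ∀ e ∈ digitBox κ, |t e| ≤ c * e none) (hh : DigitExpansion h) :
      DigitExpansion fun e => t e + e none * h e

namespace DigitExpansion

variable {g h : (Option κ → ℤ) → ℤ}

theorem congr (hg : DigitExpansion g) (H : ∀ e, h e = g e) : DigitExpansion h :=
  funext H ▸ hg

theorem add (hg : DigitExpansion g) (hh : DigitExpansion h) :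
    DigitExpansion fun e => g e + h e := by
  induction hg generalizing h with
  | zero => simpa using hh
  | cons ht c hc hg ih =>
    cases hh with
    | zero => simpa using cons ht c hc hg
    | cons ht' c' hc' hh =>
      refine (cons (ht.add ht') (c + c') (fun e he => ?_) (ih hh)).congr fun e => by ring
      rw [add_mul]
      exact (abs_add_le _ _).trans (add_le_add (hc e he) (hc' e he))

theorem smul (a : ℤ) (hh : DigitExpansion h) : DigitExpansion fun e => a * h e := by
  induction hh with
  | zero => simpa using zero
  | cons ht c hc _ ih =>
    refine (cons (ht.smul a) (|a| * c) (fun e he => ?_) ih).congr fun e => by ring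
    rw [abs_mul, mul_assoc]
    exact mul_le_mul_of_nonneg_left (hc e he) (abs_nonneg a)

theorem base_mul (hh : DigitExpansion h) : DigitExpansion fun e => e none * h e :=
  (cons (.const 0) 0 (by simp) hh).congr fun e => by simp

theorem base_pow_mul (hh : DigitExpansion h) (j : ℕ) :
    DigitExpansion fun e => e none ^ j * h e := by
  induction j with
  | zero => simpa using hh
  | succ j ih => exact ih.base_mul.congr fun e => by ring

theorem digit (i : κ) : DigitExpansion fun e => e (some i) :=
  (cons (.var (some i)) 1 (fun e he => by
    rw [one_mul, abs_of_nonneg (he.2 i).1]; exact (he.2 i).2.le) zero).congr fun e => by simp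

theorem sum {α : Type*} (S : Finset α) {h : α → (Option κ → ℤ) → ℤ}
    (hh : ∀ a ∈ S, DigitExpansion (h a)) : DigitExpansion fun e => ∑ a ∈ S, h a e := by
  classical
  induction S using Finset.induction_on with
  | empty => simpa using zero
  | insert a S ha ih =>
    exact ((hh a (by simp)).add (ih fun b hb => hh b (by simp [hb]))).congr fun e => by simp [ha]

theorem polynomial_mul (p : Polynomial ℤ) (hh : DigitExpansion h) :
    DigitExpansion fun e => p.eval (e none) * h e :=
  (sum (Finset.range (p.natDegree + 1)) fun j _ => (hh.base_pow_mul j).smul (p.coeff j)).congr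
    fun e => by rw [Polynomial.eval_eq_sum_range, Finset.sum_mul]; simp only [mul_assoc]

/-- The vanishing of a digit expansion is definable: carries are bounded. -/
theorem exists_definable_eq_zero (hh : DigitExpansion h) :
    ∃ B, FloorDefinable B ∧ ∀ e ∈ digitBox κ, e ∈ B ↔ h e = 0 := by
  suffices H : ∀ (s : (Option κ → ℤ) → ℤ) (c : ℤ), FloorLinear s →
      (∀ e ∈ digitBox κ, |s e| ≤ c * e none) →
      ∃ B, FloorDefinable B ∧ ∀ e ∈ digitBox κ, e ∈ B ↔ s e + h e = 0 by
    simpa using H (fun _ => 0) 0 (.const 0) (by simp)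
  induction hh with
  | zero => exact fun s c hs _ => ⟨_, .eq hs (.const 0), fun e _ => by simp⟩
  | @cons t h ht c' hc' _ ih =>
    intro s c hs hc
    have carry : ∀ a : ℤ, ∃ B, FloorDefinable B ∧ ∀ e ∈ digitBox κ, e ∈ B ↔ a + h e = 0 :=
      fun a => ih (fun _ => a) |a| (.const a) fun e he =>
        le_mul_of_one_le_right (abs_nonneg a) he.1
    choose B hB hBe using carry
    let l : List ℤ := (List.range (2 * (c + c').toNat + 1)).map
      fun j : ℕ => (j : ℤ) - (c + c').toNat
    refine ⟨_, FloorDefinable.biUnion l fun a _ =>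
      (FloorDefinable.eq (hs.add ht) ((FloorLinear.var none).smul a)).inter (hB a), fun e he => ?_⟩
    have hn : 0 < e none := he.1
    constructor
    · rintro ⟨a, -, ha, haB⟩
      rw [hBe a e he] at haB
      simp only [Set.mem_ofPred_eq] at ha
      linear_combination ha + e none * haB
    · intro h0
      refine ⟨-h e, ?_, ?_, (hBe _ e he).2 (by ring)⟩
      · have hb : |h e| ≤ c + c' := by
          have h₁ : |s e + t e| ≤ (c + c') * e none := by
            rw [add_mul]; exact (abs_add_le _ _).trans (add_le_add (hc e he) (hc' e he))
          rw [show s e + t e = e none * -h e by linarith, abs_mul, abs_of_pos hn, abs_neg,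
            mul_comm] at h₁
          exact le_of_mul_le_mul_right h₁ hn
        rw [abs_le] at hb
        exact List.mem_map.2 ⟨(-h e + (c + c').toNat).toNat, by simp; omega, by omega⟩
      · simp only [Set.mem_ofPred_eq]
        linarith

end DigitExpansion

end Digits

theorem sum_digits_eq_mod (n x m : ℕ) :
    ∑ j ∈ Finset.range m, x / n ^ j % n * n ^ j = x % n ^ m := by
  induction m with
  | zero => simp [Nat.mod_one]
  | succ m ih => rw [Finset.sum_range_succ, ih, Nat.mod_pow_succ, mul_comm (n ^ m)]

theorem mem_SG_iff {k : ℕ} {f : Fin k → ℕ → ℕ} {n y : ℕ} :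
    y ∈ SG k f n ↔ ∃ a : Fin k → ℕ, ∑ i, a i * f i n = y := by
  rw [SG, ← Submodule.span_nat_eq_addSubmonoidClosure, Submodule.mem_toAddSubmonoid,
    Submodule.mem_span_range_iff_exists_fun]
  simp

theorem mem_SG_iff_exists_le {k : ℕ} {f : Fin k → ℕ → ℕ} {n y : ℕ} :
    y ∈ SG k f n ↔ ∃ a : Fin k → ℕ, (∀ i, a i ≤ y) ∧ ∑ i, a i * f i n = y := by
  rw [mem_SG_iff]
  constructor
  · rintro ⟨a, ha⟩
    refine ⟨fun i => if f i n = 0 then 0 else a i, fun i => ?_, ?_⟩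
    · dsimp only
      split_ifs with h
      · exact Nat.zero_le _
      · calc a i ≤ a i * f i n := Nat.le_mul_of_pos_right _ (Nat.pos_of_ne_zero h)
          _ ≤ ∑ i, a i * f i n :=
            Finset.single_le_sum (f := fun i => a i * f i n) (fun _ _ => Nat.zero_le _)
              (Finset.mem_univ i)
          _ = y := ha
    · rw [← ha]
      refine Finset.sum_congr rfl fun i _ => ?_
      by_cases h : f i n = 0 <;> simp [h]
  · rintro ⟨a, -, ha⟩
    exact ⟨a, ha⟩

/-- Membership of a fixed multiple of a number in the semigroup is definable in terms of the
base-`n` digits of that number. -/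
theorem exists_definable_mem_SG {k : ℕ} {f : Fin k → ℕ → ℕ} {p : Fin k → Polynomial ℤ}
    (hp : ∀ i (n : ℕ), (f i n : ℤ) = (p i).eval (n : ℤ)) (R r c : ℕ) :
    ∃ B : Set (Option (ℕ ⊕ Fin k × Fin r) → ℤ), FloorDefinable B ∧
      ∀ e ∈ digitBox (ℕ ⊕ Fin k × Fin r), ∀ n x : ℕ, e none = n →
        ∑ j ∈ Finset.range R, e (some (.inl j)) * n ^ j = x → c * x < n ^ r →
          (e ∈ B ↔ c * x ∈ SG k f n) := by
  have hexp : DigitExpansion fun e : Option (ℕ ⊕ Fin k × Fin r) → ℤ =>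
      ∑ i, (p i).eval (e none) * ∑ j : Fin r, e none ^ (j : ℕ) * e (some (.inr (i, j))) +
        -(c : ℤ) * ∑ j ∈ Finset.range R, e none ^ j * e (some (.inl j)) :=
    (DigitExpansion.sum _ fun i _ => .polynomial_mul (p i)
      (.sum _ fun (j : Fin r) _ => (DigitExpansion.digit (Sum.inr (i, j))).base_pow_mul j)).add
        (.smul _ (.sum _ fun j _ => (DigitExpansion.digit (Sum.inl j)).base_pow_mul j))
  obtain ⟨B, hB, hBe⟩ := hexp.exists_definable_eq_zero
  let S : Finset (Option (ℕ ⊕ Fin k × Fin r)) := Finset.univ.image fun q => some (.inr q)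
  have hbound : FloorDefinable {e : Option (ℕ ⊕ Fin k × Fin r) → ℤ |
      ∀ i ∈ S.toList, e ∈ {e : Option (ℕ ⊕ Fin k × Fin r) → ℤ | e i < e none}} :=
    .biInter _ fun i _ => .lt (.var i) (.var none)
  refine ⟨_, (hB.inter hbound).exists_nonneg_finset S, fun e he n x hn hx hlt => ?_⟩
  have hnS : none ∉ S := by simp [S]
  have hlS : ∀ j, some (.inl j) ∉ S := by simp [S]
  have hrS : ∀ q, some (.inr q) ∈ S := by simp [S]
  have hx' : ∑ j ∈ Finset.range R, (n : ℤ) ^ j * e (some (.inl j)) = x := by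
    rw [← hx]; exact Finset.sum_congr rfl fun j _ => mul_comm _ _
  have hbox : ∀ v : Option (ℕ ⊕ Fin k × Fin r) → ℤ, (∀ i ∈ S, 0 ≤ v i) → (∀ i ∈ S, v i < n) →
      S.piecewise v e ∈ digitBox _ := fun v h₀ h₁ => by
    refine ⟨by simpa [hnS] using he.1, ?_⟩
    rintro (j | q)
    · simpa [hnS, hlS] using he.2 (.inl j)
    · simpa [hnS, hrS, hn] using ⟨h₀ _ (hrS q), h₁ _ (hrS q)⟩
  rw [mem_SG_iff_exists_le]
  constructor
  · rintro ⟨v, hv, hvB, hvn⟩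
    have hvn' : ∀ i ∈ S, v i < n := fun i hi => by
      simpa [hi, hnS, hn] using hvn i (Finset.mem_toList.2 hi)
    have h0 := (hBe _ (hbox v hv hvn')).1 hvB
    simp only [Finset.piecewise_eq_of_notMem _ _ _ hnS, Finset.piecewise_eq_of_notMem _ _ _ (hlS _),
      Finset.piecewise_eq_of_mem _ _ _ (hrS _), hn, hx', ← hp] at h0
    rw [← mem_SG_iff_exists_le, mem_SG_iff]
    refine ⟨fun i => ∑ j : Fin r, n ^ (j : ℕ) * (v (some (.inr (i, j)))).toNat, ?_⟩
    have hcast : ∀ q, ((v (some (.inr q))).toNat : ℤ) = v (some (.inr q)) := fun q =>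
      Int.toNat_of_nonneg (hv _ (hrS q))
    zify
    simp only [hcast]
    simp only [mul_comm _ ((f _ n : ℤ))]
    linarith
  · rintro ⟨a, ha, hsum⟩
    let v : Option (ℕ ⊕ Fin k × Fin r) → ℤ := fun i => match i with
      | some (.inr q) => ((a q.1 / n ^ (q.2 : ℕ) % n : ℕ) : ℤ)
      | _ => 0
    have hpos : 0 < n := by have := he.1; omega
    have hv : ∀ i ∈ S, 0 ≤ v i := by
      intro i hi
      obtain ⟨q, -, rfl⟩ := Finset.mem_image.1 hi
      exact Int.natCast_nonneg _
    have hvn : ∀ i ∈ S, v i < n := by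
      intro i hi
      obtain ⟨q, -, rfl⟩ := Finset.mem_image.1 hi
      exact Int.ofNat_lt.2 (Nat.mod_lt _ hpos)
    refine ⟨v, hv, (hBe _ (hbox v hv hvn)).2 ?_, fun i hi => ?_⟩
    · simp only [Finset.piecewise_eq_of_notMem _ _ _ hnS,
        Finset.piecewise_eq_of_notMem _ _ _ (hlS _), Finset.piecewise_eq_of_mem _ _ _ (hrS _), hn,
        hx', ← hp, v]
      have hdig : ∀ i, ∑ j : Fin r, (n : ℤ) ^ (j : ℕ) * ((a i / n ^ (j : ℕ) % n : ℕ) : ℤ) = a i :=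
        fun i => by
          have h := sum_digits_eq_mod n (a i) r
          rw [Nat.mod_eq_of_lt ((ha i).trans_lt hlt), ← Fin.sum_univ_eq_sum_range
            (fun j => a i / n ^ j % n * n ^ j)] at h
          rw [← Int.natCast_inj] at h
          rw [← h]
          push_cast
          exact Finset.sum_congr rfl fun j _ => mul_comm _ _
      simp only [hdig]
      zify at hsum
      simp only [mul_comm _ ((f _ n : ℤ))] at hsum
      rw [hsum]; ring
    · have hi' := Finset.mem_toList.1 hi
      simpa [hi', hnS, hn] using hvn i hi'

section SetDigits

variable {τ : Type*}

/-- Replace the first `m` digits of the first family by the base-`n` digits of `x`. -/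
def setDigits (m x : ℕ) (e : Option (ℕ ⊕ τ) → ℤ) : Option (ℕ ⊕ τ) → ℤ
  | some (.inl j) =>
    if j < m then ((x / (e none).toNat ^ j % (e none).toNat : ℕ) : ℤ) else e (some (.inl j))
  | i => e i

theorem setDigits_succ [DecidableEq τ] {m n x d : ℕ} {e : Option (ℕ ⊕ τ) → ℤ} (hn : e none = n)
    (hx : x < n ^ m) (hd : d < n) :
    setDigits (m + 1) (n ^ m * d + x) e = setDigits m x (update e (some (.inl m)) d) := by
  funext i
  match i with
  | none => simp [setDigits]
  | some (.inr q) => simp [setDigits]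
  | some (.inl j) =>
    simp only [setDigits, ne_eq, reduceCtorEq, not_false_eq_true, update_of_ne, hn,
      Int.toNat_natCast]
    rcases lt_trichotomy j m with h | rfl | h
    · rw [if_pos (by omega), if_pos h]
      obtain ⟨l, rfl⟩ := Nat.exists_eq_add_of_lt h
      have hpos : 0 < n ^ j := pow_pos (by omega) j
      rw [show n ^ (j + l + 1) * d + x = n ^ j * (n * (n ^ l * d)) + x by ring,
        Nat.mul_add_div hpos, Nat.mul_add_mod]
    · have hpos : 0 < n ^ j := pow_pos (by omega) j
      simp [Nat.mul_add_div hpos, Nat.div_eq_of_lt hx, Nat.mod_eq_of_lt hd]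
    · rw [if_neg (by omega), if_neg (by omega), update_of_ne (by simpa using h.ne')]

theorem setDigits_mem_digitBox {m x : ℕ} {e : Option (ℕ ⊕ τ) → ℤ} (he : e ∈ digitBox (ℕ ⊕ τ)) :
    setDigits m x e ∈ digitBox (ℕ ⊕ τ) := by
  refine ⟨he.1, ?_⟩
  rintro (j | q)
  · simp only [setDigits]
    split_ifs with h
    · have h1 := he.1
      have := Nat.mod_lt (x / (e none).toNat ^ j) (y := (e none).toNat) (by omega)
      omega
    · exact he.2 (.inl j)
  · exact he.2 (.inr q)

/-- Summing a floor-polynomial function over all values of the first `m` digits. -/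
theorem FloorPolynomial.sum_setDigits [DecidableEq τ] {F : (Option (ℕ ⊕ τ) → ℤ) → ℚ}
    (hF : FloorPolynomial F) (m : ℕ) :
    FloorPolynomial fun e => ∑ x ∈ Finset.range ((e none).toNat ^ m), F (setDigits m x e) := by
  induction m with
  | zero =>
    refine hF.congr fun e => ?_
    have : setDigits 0 0 e = e := by
      funext i
      match i with
      | none => rfl
      | some (.inr q) => rfl
      | some (.inl j) => simp [setDigits]
    simp [this]
  | succ m ih =>
    refine (ih.sum_range (.var none) (some (.inl m))).congr fun e => ?_
    rcases le_or_gt (e none) 0 with h | h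
    · simp [Int.toNat_of_nonpos h]
    · obtain ⟨n, hn⟩ := Int.eq_ofNat_of_zero_le h.le
      simp only [hn, Int.toNat_natCast, ne_eq, reduceCtorEq, not_false_eq_true, update_of_ne]
      rw [Finset.sum_sigma']
      have hpos : 0 < n ^ m := pow_pos (by omega) m
      refine Finset.sum_bij' (fun x _ => ⟨x / n ^ m, x % n ^ m⟩) (fun p _ => n ^ m * p.1 + p.2)
        ?_ ?_ ?_ ?_ ?_
      · intro x hx
        simp only [Finset.mem_range, pow_succ] at hx
        simpa [Nat.mod_lt x hpos] using Nat.div_lt_of_lt_mul hx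
      · rintro ⟨d, x⟩ hp
        simp only [Finset.mem_sigma, Finset.mem_range] at hp ⊢
        calc n ^ m * d + x < n ^ m * d + n ^ m := by omega
          _ = n ^ m * (d + 1) := by ring
          _ ≤ n ^ m * n := Nat.mul_le_mul_left _ hp.1
          _ = n ^ (m + 1) := (pow_succ n m).symm
      · intro x _
        exact Nat.div_add_mod x _
      · rintro ⟨d, x⟩ hp
        simp only [Finset.mem_sigma, Finset.mem_range] at hp
        simp [Nat.mul_add_div hpos, Nat.div_eq_of_lt hp.2, Nat.mod_eq_of_lt hp.2]
      · intro x hx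
        simp only [Finset.mem_range, pow_succ] at hx
        rw [← setDigits_succ hn (Nat.mod_lt x hpos) (Nat.div_lt_of_lt_mul hx), Nat.div_add_mod]

end SetDigits

theorem mem_FG_iff {k : ℕ} {f : Fin k → ℕ → ℕ} {n x : ℕ} :
    x ∈ FG k f n ↔ x ∉ SG k f n ∧ 2 * x ∈ SG k f n ∧ 3 * x ∈ SG k f n := by
  refine and_congr_right fun _ => ⟨fun h => ⟨h 2 le_rfl, h 3 (by norm_num)⟩, fun h j hj => ?_⟩
  induction j using Nat.strong_induction_on with
  | _ j ih =>
    rcases (show j = 2 ∨ j = 3 ∨ 4 ≤ j by omega) with rfl | rfl | hj'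
    · exact h.1
    · exact h.2
    · have := add_mem (ih (j - 2) (by omega) (by omega)) h.1
      rwa [← add_mul, Nat.sub_add_cancel hj] at this

/-- A cofinite semigroup contains every number from an explicit bound on. -/
theorem mem_SG_of_finite_compl {k : ℕ} {f : Fin k → ℕ → ℕ} {n : ℕ}
    (hfin : ((SG k f n : Set ℕ)ᶜ).Finite) {x : ℕ} (hx : (∑ i, f i n) ^ 2 ≤ x) :
    x ∈ SG k f n := by
  obtain ⟨N, hN⟩ := hfin.bddAbove
  have hmem : ∀ y, N < y → y ∈ SG k f n := fun y hy => by
    by_contra h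
    exact absurd (hN h) (not_le.2 hy)
  obtain ⟨i₀, hi₀⟩ : ∃ i, f i n ≠ 0 := by
    by_contra! h
    obtain ⟨a, ha⟩ := mem_SG_iff.1 (hmem (N + 1) (by omega))
    simp [h] at ha
  set q := f i₀ n with hq
  have hq0 : 0 < q := Nat.pos_of_ne_zero hi₀
  obtain ⟨a, ha⟩ := mem_SG_iff.1 (hmem (x + q * (N + 1)) (by nlinarith))
  have hmod : (∑ i, a i % q * f i n) ≡ x [MOD q] := by
    have h₁ : (∑ i, a i % q * f i n) ≡ ∑ i, a i * f i n [MOD q] := by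
      rw [← ZMod.natCast_eq_natCast_iff]
      push_cast
      simp
    rw [ha] at h₁
    exact h₁.trans (by simp [Nat.ModEq])
  have hle : ∑ i, a i % q * f i n ≤ x := by
    refine le_trans ?_ hx
    rw [sq, Finset.mul_sum]
    refine Finset.sum_le_sum fun i _ => Nat.mul_le_mul_right _ ?_
    exact (Nat.mod_lt _ hq0).le.trans (Finset.single_le_sum (f := fun i => f i n)
      (fun _ _ => Nat.zero_le _) (Finset.mem_univ i₀))
  obtain ⟨c, hc⟩ := (Nat.modEq_iff_dvd' hle).1 hmod
  have hx' : x = ∑ i, a i % q * f i n + c • q := by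
    rw [smul_eq_mul, mul_comm c, ← hc]; omega
  rw [hx']
  exact add_mem (mem_SG_iff.2 ⟨_, rfl⟩)
    (nsmul_mem (AddSubmonoid.subset_closure (Set.mem_range_self i₀)) c)

theorem Polynomial.exists_abs_eval_le_pow (p : Polynomial ℤ) :
    ∃ s N : ℕ, ∀ n : ℕ, N ≤ n → |p.eval (n : ℤ)| ≤ (n : ℤ) ^ s := by
  refine ⟨p.natDegree + 1, max 1 (∑ i ∈ Finset.range (p.natDegree + 1), |p.coeff i|).toNat,
    fun n hn => ?_⟩
  have h1 : (1 : ℤ) ≤ n := by exact_mod_cast (le_max_left _ _).trans hn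
  have hC : ∑ i ∈ Finset.range (p.natDegree + 1), |p.coeff i| ≤ (n : ℤ) :=
    Int.toNat_le.1 ((le_max_right _ _).trans hn)
  calc |p.eval (n : ℤ)|
      ≤ ∑ i ∈ Finset.range (p.natDegree + 1), |p.coeff i * (n : ℤ) ^ i| := by
        rw [Polynomial.eval_eq_sum_range]; exact Finset.abs_sum_le_sum_abs _ _
    _ ≤ ∑ i ∈ Finset.range (p.natDegree + 1), |p.coeff i| * (n : ℤ) ^ p.natDegree := by
        refine Finset.sum_le_sum fun i hi => ?_
        rw [abs_mul, abs_of_nonneg (pow_nonneg (by omega) i : (0 : ℤ) ≤ (n : ℤ) ^ i)]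
        exact mul_le_mul_of_nonneg_left
          (pow_le_pow_right₀ h1 (Nat.lt_succ_iff.1 (Finset.mem_range.1 hi))) (abs_nonneg _)
    _ ≤ (n : ℤ) ^ (p.natDegree + 1) := by
        rw [← Finset.sum_mul, pow_succ']
        exact mul_le_mul_of_nonneg_right hC (by positivity)

/-- The number of fundamental gaps below `n ^ R` is eventually given by a floor-polynomial
function. -/
theorem exists_floorPolynomial_card_FG {k : ℕ} {f : Fin k → ℕ → ℕ} {p : Fin k → Polynomial ℤ}
    (hp : ∀ i (n : ℕ), (f i n : ℤ) = (p i).eval (n : ℤ)) (R : ℕ) :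
    ∃ F : (Option (ℕ ⊕ Fin k × Fin (R + 1)) → ℤ) → ℚ, FloorPolynomial F ∧
      ∀ n : ℕ, 4 ≤ n →
        ((FG k f n ∩ Set.Iio (n ^ R)).ncard : ℚ) = F (update 0 none n) := by
  classical
  obtain ⟨B₁, hB₁, h₁⟩ := exists_definable_mem_SG hp R (R + 1) 1
  obtain ⟨B₂, hB₂, h₂⟩ := exists_definable_mem_SG hp R (R + 1) 2
  obtain ⟨B₃, hB₃, h₃⟩ := exists_definable_mem_SG hp R (R + 1) 3
  refine ⟨_, (FloorPolynomial.ite (hB₁.compl.inter (hB₂.inter hB₃)) (.const 1)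
    (.const 0)).sum_setDigits R, fun n hn => ?_⟩
  simp only [update_self, Int.toNat_natCast]
  have hcard : ((FG k f n ∩ Set.Iio (n ^ R)).ncard : ℚ) =
      ∑ x ∈ Finset.range (n ^ R), if x ∈ FG k f n then 1 else 0 := by
    rw [Finset.sum_boole, ← Set.ncard_coe_finset]
    congr 2
    ext x
    simp [and_comm]
  rw [hcard]
  refine Finset.sum_congr rfl fun x hx => if_congr ?_ rfl rfl
  rw [Finset.mem_range] at hx
  rw [Set.mem_inter_iff, Set.mem_inter_iff, Set.mem_compl_iff]
  have hbox : setDigits R x (update (0 : Option (ℕ ⊕ Fin k × Fin (R + 1)) → ℤ) none n) ∈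
      digitBox _ := by
    refine setDigits_mem_digitBox ⟨?_, fun i => ?_⟩ <;> simp <;> omega
  have hsum : ∑ j ∈ Finset.range R,
      setDigits R x (update (0 : Option (ℕ ⊕ Fin k × Fin (R + 1)) → ℤ) none n) (some (.inl j)) *
        (n : ℤ) ^ j = x := by
    have h := sum_digits_eq_mod n x R
    rw [Nat.mod_eq_of_lt hx, ← Int.natCast_inj] at h
    rw [← h]
    push_cast
    refine Finset.sum_congr rfl fun j hj => ?_
    simp [setDigits, Finset.mem_range.1 hj]
  have hlt : ∀ c ≤ 3, c * x < n ^ (R + 1) := fun c hc => by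
    rw [pow_succ]; nlinarith
  have hnone : setDigits R x (update (0 : Option (ℕ ⊕ Fin k × Fin (R + 1)) → ℤ) none n) none =
      (n : ℤ) := by simp [setDigits]
  rw [mem_FG_iff, h₁ _ hbox n x hnone hsum (hlt 1 (by norm_num)),
    h₂ _ hbox n x hnone hsum (hlt 2 (by norm_num)), h₃ _ hbox n x hnone hsum (hlt 3 le_rfl),
    one_mul]

theorem stmt7 (k : ℕ) (hk : 1 ≤ k) (f : Fin k → ℕ → ℕ)
    (hf : ∀ i, ∃ p : Polynomial ℤ, ∀ n : ℕ, (f i n : ℤ) = p.eval (n : ℤ)) :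
    ∃ g : ℕ → ℤ, IsEQP g ∧
      ∀ n : ℕ, ((SG k f n : Set ℕ)ᶜ).Finite →
        g n = ((FG k f n).ncard : ℤ) := by
  choose p hp using hf
  obtain ⟨s, N, hsN⟩ := (∑ i, p i).exists_abs_eval_le_pow
  obtain ⟨F, hF, hFn⟩ := exists_floorPolynomial_card_FG hp (s * 2)
  refine ⟨fun n => if max N 4 ≤ n then ((FG k f n ∩ Set.Iio (n ^ (s * 2))).ncard : ℤ)
    else ((FG k f n).ncard : ℤ), hF.isEQP 0 none (n₀ := max N 4) fun n hn => ?_, fun n hfin => ?_⟩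
  · rw [if_pos hn, ← hFn n ((le_max_right _ _).trans hn), Int.cast_natCast]
  · dsimp only
    split_ifs with hn
    · have hsum : ∑ i, f i n ≤ n ^ s := by
        have h := hsN n ((le_max_left _ _).trans hn)
        rw [Polynomial.eval_finsetSum] at h
        simp only [← hp] at h
        exact_mod_cast (le_abs_self _).trans h
      rw [Set.inter_eq_left.2 fun x hx => ?_]
      refine lt_of_not_ge fun hle => hx.1 (mem_SG_of_finite_compl hfin (le_trans ?_ hle))
      rw [pow_mul]
      exact Nat.pow_le_pow_left hsum 2
    · rfl
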